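/- Let K₁, …, Kₙ ⊆ ℝ^d be convex sets and let S = ℝ^d \ (K₁ ∪ … ∪ Kₙ). For every p ∈ S with dm(S, p) = k and every ε > 0, there exists a k-ordinary point q of S with ‖p − q‖ < ε; consequently, every p ∈ S with dm(S, p) = k is contained in some k-ordinary flat of S. -/

import Mathlib

open Metric Set Module

/-- `HasSimplex S k` : the set `S` contains a `k`-simplex, i.e. the convex hull
of `k+1` affinely independent points. -/
def HasSimplex {d : ℕ} (S : Set (EuclideanSpace ℝ (Fin d))) (k : ℕ) : Prop :=
  ∃ f : Fin (k + 1) → EuclideanSpace ℝ (Fin d),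
    AffineIndependent ℝ f ∧ convexHull ℝ (Set.range f) ⊆ S

/-- The flat-dimension `dm S` of a set `S ⊆ ℝ^d`: the maximal `k` such that `S`
contains a `k`-simplex. -/
noncomputable def dm {d : ℕ} (S : Set (EuclideanSpace ℝ (Fin d))) : ℕ :=
  sSup {k : ℕ | HasSimplex S k}

/-- The local dimension `dmLoc S p` of `S` at `p`: the minimum over `ε > 0` of
the flat-dimension of `S ∩ B(p, ε)`. -/
noncomputable def dmLoc {d : ℕ} (S : Set (EuclideanSpace ℝ (Fin d)))
    (p : EuclideanSpace ℝ (Fin d)) : ℕ :=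
  sInf {m : ℕ | ∃ ε > 0, m = dm (S ∩ ball p ε)}

/-- `p` is a `k`-ordinary point of `S`: its local dimension is `k` and, near `p`,
`S` coincides with a `k`-flat. -/
def IsOrdinaryPoint {d : ℕ} (S : Set (EuclideanSpace ℝ (Fin d))) (k : ℕ)
    (p : EuclideanSpace ℝ (Fin d)) : Prop :=
  p ∈ S ∧ dmLoc S p = k ∧
    ∃ H : AffineSubspace ℝ (EuclideanSpace ℝ (Fin d)),
      finrank ℝ H.direction = k ∧
      ∃ U, IsOpen U ∧ p ∈ U ∧ S ∩ U = (H : Set (EuclideanSpace ℝ (Fin d))) ∩ U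

/-- `H` is a `k`-ordinary flat of `S`: `H` is a `k`-flat which witnesses some
`k`-ordinary point of `S`. -/
def IsOrdinaryFlat {d : ℕ} (S : Set (EuclideanSpace ℝ (Fin d))) (k : ℕ)
    (H : AffineSubspace ℝ (EuclideanSpace ℝ (Fin d))) : Prop :=
  finrank ℝ H.direction = k ∧
    ∃ p ∈ S, dmLoc S p = k ∧
      ∃ U, IsOpen U ∧ p ∈ U ∧ S ∩ U = (H : Set (EuclideanSpace ℝ (Fin d))) ∩ U


open Filter Topology

/-- A nonempty flat of dimension `m` is the injective affine image of `ℝ^m`. -/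
lemma exists_affineMap_range_eq {d m : ℕ} (L : AffineSubspace ℝ (EuclideanSpace ℝ (Fin d)))
    (hne : (L : Set (EuclideanSpace ℝ (Fin d))).Nonempty) (hm : finrank ℝ L.direction = m) :
    ∃ ψ : EuclideanSpace ℝ (Fin m) →ᵃ[ℝ] EuclideanSpace ℝ (Fin d),
      Function.Injective ψ ∧ Set.range ψ = L := by
  obtain ⟨a, ha⟩ := hne
  have e : EuclideanSpace ℝ (Fin m) ≃ₗ[ℝ] L.direction :=
    LinearEquiv.ofFinrankEq _ _ (by simp [hm])
  refine ⟨(L.direction.subtype ∘ₗ e.toLinearMap).toAffineMap + AffineMap.const ℝ _ a, ?_, ?_⟩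
  · intro u v huv
    simpa using huv
  · ext x
    constructor
    · rintro ⟨u, rfl⟩
      have := AffineSubspace.vadd_mem_of_mem_direction (e u).2 ha
      simpa using this
    · intro hx
      refine ⟨e.symm ⟨x - a, ?_⟩, ?_⟩
      · simpa using AffineSubspace.vsub_mem_direction hx ha
      · simp

/-- An affine map sending a nonempty open set into a flat sends everything into it. -/
lemma mem_of_image_open_subset {d m : ℕ}
    (ψ : EuclideanSpace ℝ (Fin m) →ᵃ[ℝ] EuclideanSpace ℝ (Fin d))
    {L : AffineSubspace ℝ (EuclideanSpace ℝ (Fin d))} {O : Set (EuclideanSpace ℝ (Fin m))}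
    (hO : IsOpen O) (hne : O.Nonempty) (h : ψ '' O ⊆ L) (u : EuclideanSpace ℝ (Fin m)) :
    ψ u ∈ L := by
  have hspan : affineSpan ℝ O ≤ L.comap ψ :=
    affineSpan_le.2 fun v hv => h (mem_image_of_mem ψ hv)
  rw [hO.affineSpan_eq_top hne] at hspan
  exact hspan (AffineSubspace.mem_top ℝ _ u)

/-- The injective affine image of a nonempty open subset of `ℝ^m` contains an `m`-simplex. -/
lemma hasSimplex_image {d m : ℕ} {ψ : EuclideanSpace ℝ (Fin m) →ᵃ[ℝ] EuclideanSpace ℝ (Fin d)}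
    (hψ : Function.Injective ψ) {O : Set (EuclideanSpace ℝ (Fin m))}
    (hO : IsOpen O) (hne : O.Nonempty) : HasSimplex (ψ '' O) m := by
  obtain ⟨u, hu⟩ := hne
  obtain ⟨r, hr, hball⟩ := Metric.isOpen_iff.1 hO u hu
  obtain ⟨s, hs, hind, hspan⟩ :=
    (isOpen_ball (x := u) (ε := r)).exists_subset_affineIndependent_span_eq_top
      ⟨u, mem_ball_self hr⟩
  have hfin : Finite s := finite_of_fin_dim_affineIndependent ℝ hind
  have : Fintype s := Fintype.ofFinite s
  have hcard : Fintype.card s = m + 1 := by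
    have h := (hind.affineSpan_eq_top_iff_card_eq_finrank_add_one).1
      (by simpa using hspan)
    simpa using h
  let e : Fin (m + 1) ≃ s := (Fintype.equivFinOfCardEq hcard).symm
  refine ⟨fun i => ψ (e i), ?_, ?_⟩
  · exact (hind.comp_embedding e.toEmbedding).map' ψ hψ
  · have hrange : Set.range (fun i => ψ (e i)) ⊆ ψ '' ball u r := by
      rintro _ ⟨i, rfl⟩
      exact mem_image_of_mem ψ (hs (e i).2)
    exact (convexHull_min hrange ((convex_ball u r).affine_image ψ)).trans (image_mono hball)

lemma HasSimplex.mono {d k : ℕ} {S T : Set (EuclideanSpace ℝ (Fin d))} (h : HasSimplex S k)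
    (hST : S ⊆ T) : HasSimplex T k :=
  let ⟨f, hf, hfS⟩ := h
  ⟨f, hf, hfS.trans hST⟩

lemma HasSimplex.le_finrank {d k : ℕ} {S : Set (EuclideanSpace ℝ (Fin d))}
    (h : HasSimplex S k) : k ≤ d := by
  obtain ⟨f, hf, -⟩ := h
  have hcard := hf.card_le_finrank_succ
  have hle := Submodule.finrank_le (vectorSpan ℝ (Set.range f))
  simp only [Fintype.card_fin, finrank_euclideanSpace_fin] at hcard hle
  omega

lemma HasSimplex.le_dm {d k : ℕ} {S : Set (EuclideanSpace ℝ (Fin d))} (h : HasSimplex S k) :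
    k ≤ dm S :=
  le_csSup ⟨d, fun _ hl => hl.le_finrank⟩ h

lemma hasSimplex_dm {d : ℕ} {S : Set (EuclideanSpace ℝ (Fin d))} (hS : S.Nonempty) :
    HasSimplex S (dm S) := by
  obtain ⟨p, hp⟩ := hS
  refine Nat.sSup_mem (s := {k | HasSimplex S k}) ⟨0, fun _ => p, ?_, ?_⟩
    ⟨d, fun _ hl => hl.le_finrank⟩
  · have : Subsingleton (Fin (0 + 1)) := inferInstanceAs (Subsingleton (Fin 1))
    exact affineIndependent_of_subsingleton ℝ _
  · simpa using hp

lemma dmLoc_le {d : ℕ} (S : Set (EuclideanSpace ℝ (Fin d))) (p : EuclideanSpace ℝ (Fin d))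
    {ε : ℝ} (hε : 0 < ε) : dmLoc S p ≤ dm (S ∩ ball p ε) :=
  Nat.sInf_le ⟨ε, hε, rfl⟩

lemma exists_dmLoc_eq {d : ℕ} (S : Set (EuclideanSpace ℝ (Fin d)))
    (p : EuclideanSpace ℝ (Fin d)) : ∃ ε > 0, dmLoc S p = dm (S ∩ ball p ε) :=
  Nat.sInf_mem (s := {m : ℕ | ∃ ε > 0, m = dm (S ∩ ball p ε)}) ⟨_, 1, one_pos, rfl⟩

/-- Local dimension is attained on all sufficiently small balls. -/
lemma dm_inter_ball_eq {d : ℕ} {S : Set (EuclideanSpace ℝ (Fin d))}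
    {p : EuclideanSpace ℝ (Fin d)} (hp : p ∈ S) {ε ε₀ : ℝ} (hε : 0 < ε) (hle : ε ≤ ε₀)
    (h₀ : dmLoc S p = dm (S ∩ ball p ε₀)) : dm (S ∩ ball p ε) = dmLoc S p := by
  refine le_antisymm ?_ (dmLoc_le S p hε)
  rw [h₀]
  exact ((hasSimplex_dm (S := S ∩ ball p ε) ⟨p, hp, mem_ball_self hε⟩).mono
    (inter_subset_inter_right _ (ball_subset_ball hle))).le_dm

/-- If a set is contained in the closure of a finite union, then a nonempty relatively open part
of it is contained in the closure of one of the members. -/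
lemma exists_open_inter_subset_closure {X ι : Type*} [TopologicalSpace X] [Finite ι] {P : Set X}
    (hP : P.Nonempty) (A : ι → Set X) (h : P ⊆ closure (⋃ j, A j)) :
    ∃ j, ∃ U, IsOpen U ∧ (P ∩ U).Nonempty ∧ P ∩ U ⊆ closure (A j) := by
  classical
  have := Fintype.ofFinite ι
  by_contra! hcon
  have key : ∀ s : Finset ι, ∃ U, IsOpen U ∧ (P ∩ U).Nonempty ∧ ∀ j ∈ s, Disjoint U (A j) := by
    intro s
    induction s using Finset.induction with
    | empty => exact ⟨univ, isOpen_univ, by simpa using hP, by simp⟩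
    | insert j s _ ih =>
      obtain ⟨U, hU, hne, hdisj⟩ := ih
      obtain ⟨x, hx, hxA⟩ := Set.not_subset.1 (hcon j U hU hne)
      refine ⟨U ∩ (closure (A j))ᶜ, hU.inter isClosed_closure.isOpen_compl,
        ⟨x, hx.1, hx.2, hxA⟩, ?_⟩
      intro i hi
      rcases Finset.mem_insert.1 hi with rfl | hi
      · exact Set.disjoint_left.2 fun y hy hyA => hy.2 (subset_closure hyA)
      · exact (hdisj i hi).mono_left inter_subset_left
  obtain ⟨U, hU, ⟨x, hxP, hxU⟩, hdisj⟩ := key Finset.univ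
  obtain ⟨y, hyU, hy⟩ := mem_closure_iff.1 (h hxP) U hU hxU
  obtain ⟨j, hj⟩ := mem_iUnion.1 hy
  exact Set.disjoint_left.1 (hdisj j (Finset.mem_univ j)) hyU hj

/-- In finite dimension, the closure of a convex set has the same interior. -/
lemma Convex.interior_closure_eq_interior_of_finrank {E : Type*} [NormedAddCommGroup E]
    [NormedSpace ℝ E] [FiniteDimensional ℝ E] {s : Set E} (hs : Convex ℝ s) :
    interior (closure s) = interior s := by
  refine Subset.antisymm ?_ (interior_mono subset_closure)
  rcases (interior (closure s)).eq_empty_or_nonempty with h | h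
  · simp [h]
  · have hsub : closure s ⊆ affineSpan ℝ s :=
      closure_minimal (subset_affineSpan ℝ s) (AffineSubspace.closed_of_finiteDimensional _)
    have htop : affineSpan ℝ s = ⊤ := by
      refine top_le_iff.1 ?_
      rw [← isOpen_interior.affineSpan_eq_top h]
      exact affineSpan_le.2 (interior_subset.trans hsub)
    rw [hs.interior_closure_eq_interior_of_nonempty_interior
      (hs.interior_nonempty_iff_affineSpan_eq_top.2 htop)]

/-- If `D` spans the space, avoids the convex sets `K i`, and its points all lie in the closures of
the same `K i`, then arbitrarily near each point of `D` some nonempty open set avoids every `K i`: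
one continues past that point on rays coming from the interior of the hull of `D`. -/
lemma exists_open_subset_compl_near {m : ℕ} {ι : Type*} [Finite ι]
    {K : ι → Set (EuclideanSpace ℝ (Fin m))} (hK : ∀ i, Convex ℝ (K i)) {J : Set ι}
    {D : Set (EuclideanSpace ℝ (Fin m))} (hspan : affineSpan ℝ D = ⊤)
    (hDK : ∀ u ∈ D, ∀ i, u ∉ K i) (hDJ : ∀ u ∈ D, {i | u ∈ closure (K i)} = J)
    {u : EuclideanSpace ℝ (Fin m)} (hu : u ∈ D) {N : Set (EuclideanSpace ℝ (Fin m))}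
    (hN : IsOpen N) (huN : u ∈ N) :
    ∃ O, IsOpen O ∧ O.Nonempty ∧ O ⊆ N ∧ ∀ z ∈ O, ∀ i, z ∉ K i := by
  obtain ⟨y, hy⟩ := interior_convexHull_nonempty_iff_affineSpan_eq_top.2 hspan
  let N' : Set (EuclideanSpace ℝ (Fin m)) := N ∩ ⋂ i : {i // i ∉ J}, (closure (K i))ᶜ
  have hN' : IsOpen N' :=
    hN.inter (isOpen_iInter_of_finite fun _ => isClosed_closure.isOpen_compl)
  have huN' : u ∈ N' := by
    refine ⟨huN, mem_iInter.2 fun i hi => i.2 ?_⟩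
    exact (hDJ u hu).subset hi
  have hcont : Continuous fun t : ℝ => u + t • (u - y) := by fun_prop
  have hev : ∀ᶠ t in 𝓝[>] (0 : ℝ), u + t • (u - y) ∈ N' := by
    refine nhdsWithin_le_nhds (hcont.continuousAt.eventually_mem (hN'.mem_nhds ?_))
    simpa using huN'
  obtain ⟨t, htN, ht⟩ := (hev.and self_mem_nhdsWithin).exists
  have ht : 0 < t := ht
  refine ⟨N' ∩ (fun z => u + t⁻¹ • (u - z)) ⁻¹' interior (convexHull ℝ D),
    hN'.inter (isOpen_interior.preimage (by fun_prop)), ⟨_, htN, ?_⟩,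
    inter_subset_left.trans inter_subset_left, ?_⟩
  · have : u + t⁻¹ • (u - (u + t • (u - y))) = y := by
      rw [sub_add_cancel_left, smul_neg, smul_smul, inv_mul_cancel₀ ht.ne']
      module
    rw [mem_preimage, this]
    exact hy
  · rintro z ⟨hzN, hz⟩ i hzi
    by_cases hi : i ∈ J
    · have hsub : convexHull ℝ D ⊆ closure (K i) := by
        refine convexHull_min (fun v hv => ?_) (hK i).closure
        rw [← hDJ v hv] at hi
        exact hi
      have hz' := interior_mono hsub hz
      rw [(hK i).interior_closure_eq_interior_of_finrank] at hz'
      refine hDK u hu i (interior_subset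
        ((hK i).openSegment_interior_self_subset_interior hz' hzi ?_))
      refine ⟨t / (1 + t), 1 / (1 + t), by positivity, by positivity, by field_simp; ring, ?_⟩
      ext j
      simp
      field_simp
      ring
    · exact mem_iInter.1 hzN.2 ⟨i, hi⟩ (subset_closure hzi)

/-- Let `Q` avoid finitely many convex sets and accumulate at every point of `P`. Then a flat
contains a nonempty relatively open part of `P`, and some point of `Q` on this flat is a limit of
relatively open parts of the flat avoiding the convex sets. -/
lemma exists_flat_accumulating {d : ℕ} {ι : Type*} [Finite ι]
    {K : ι → Set (EuclideanSpace ℝ (Fin d))} (hK : ∀ i, Convex ℝ (K i))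
    {P Q : Set (EuclideanSpace ℝ (Fin d))} (hQ : Q ⊆ (⋃ i, K i)ᶜ) (hP : P.Nonempty)
    (hPQ : P ⊆ closure Q) :
    ∃ (m : ℕ) (φ : EuclideanSpace ℝ (Fin m) →ᵃ[ℝ] EuclideanSpace ℝ (Fin d)),
      Function.Injective φ ∧
      (∃ U, IsOpen U ∧ (P ∩ U).Nonempty ∧ P ∩ U ⊆ Set.range φ) ∧
      ∃ x ∈ Q ∩ Set.range φ, ∀ V, IsOpen V → x ∈ V →
        ∃ O, IsOpen O ∧ O.Nonempty ∧ φ '' O ⊆ (⋃ i, K i)ᶜ ∩ V := by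
  classical
  have hex : ∃ m, ∃ φ : EuclideanSpace ℝ (Fin m) →ᵃ[ℝ] EuclideanSpace ℝ (Fin d),
      Function.Injective φ ∧
      ∃ U, IsOpen U ∧ (P ∩ U).Nonempty ∧ P ∩ U ⊆ closure (Q ∩ Set.range φ) :=
    ⟨d, AffineMap.id ℝ _, fun _ _ h => h, univ, isOpen_univ, by simpa using hP,
      by simpa using hPQ⟩
  obtain ⟨φ, hφ, U, hU, hne, hcl⟩ := Nat.find_spec hex
  have hmin := fun m' => Nat.find_min hex (m := m')
  generalize Nat.find hex = m at φ hφ hcl hmin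
  have hφc : Continuous φ := φ.continuous_of_finiteDimensional
  let index : EuclideanSpace ℝ (Fin m) → Set ι := fun u => {i | u ∈ closure (φ ⁻¹' K i)}
  obtain ⟨J, U', hU', hne', hcl'⟩ := exists_open_inter_subset_closure hne
    (fun J : Set ι => φ '' {u | φ u ∈ Q ∧ index u = J}) (by
      refine hcl.trans (closure_mono ?_)
      rintro _ ⟨hq, u, rfl⟩
      exact mem_iUnion.2 ⟨index u, u, ⟨hq, rfl⟩, rfl⟩)
  rw [inter_assoc] at hne' hcl'
  have hUU : IsOpen (U ∩ U') := hU.inter hU'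
  let D : Set (EuclideanSpace ℝ (Fin m)) := {u | φ u ∈ Q ∧ index u = J}
  have hspan : affineSpan ℝ D = ⊤ := by
    by_contra hspan
    obtain ⟨x, hx⟩ := hne'
    obtain ⟨_, u, hu, -⟩ := closure_nonempty_iff.1 ⟨x, hcl' hx⟩
    have hune : (affineSpan ℝ D : Set (EuclideanSpace ℝ (Fin m))).Nonempty :=
      ⟨u, subset_affineSpan ℝ D hu⟩
    obtain ⟨ψ, hψ, hrange⟩ := exists_affineMap_range_eq (affineSpan ℝ D) hune rfl
    have hlt : finrank ℝ (affineSpan ℝ D).direction < m := by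
      have hdir : (affineSpan ℝ D).direction ≠ ⊤ := fun h =>
        hspan ((AffineSubspace.direction_eq_top_iff_of_nonempty hune).1 h)
      simpa using Submodule.finrank_lt hdir
    refine hmin _ hlt ⟨φ.comp ψ, hφ.comp hψ, U ∩ U', hUU, ⟨x, hx⟩, hcl'.trans (closure_mono ?_)⟩
    rintro _ ⟨v, hv, rfl⟩
    obtain ⟨w, hw⟩ : v ∈ Set.range ψ := hrange ▸ subset_affineSpan ℝ D hv
    exact ⟨hv.1, w, by simp [hw]⟩
  have hclosed : IsClosed (Set.range φ) := by
    have h := AffineSubspace.closed_of_finiteDimensional ((⊤ : AffineSubspace ℝ _).map φ)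
    simpa using h
  obtain ⟨u, hu⟩ : D.Nonempty := by
    obtain ⟨x, hx⟩ := hne'
    obtain ⟨_, u, hu, -⟩ := closure_nonempty_iff.1 ⟨x, hcl' hx⟩
    exact ⟨u, hu⟩
  refine ⟨m, φ, hφ, ⟨U, hU, hne, hcl.trans (closure_minimal inter_subset_right hclosed)⟩,
    φ u, ⟨hu.1, u, rfl⟩, fun V hV hxV => ?_⟩
  obtain ⟨O, hO, hOne, hON, hOK⟩ := exists_open_subset_compl_near
    (fun i => (hK i).affine_preimage φ) hspan
    (fun v hv i hvi => hQ hv.1 (mem_iUnion.2 ⟨i, hvi⟩)) (fun v hv => hv.2) hu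
    (hV.preimage hφc) hxV
  refine ⟨O, hO, hOne, ?_⟩
  rintro _ ⟨z, hz, rfl⟩
  refine ⟨fun h => ?_, hON hz⟩
  obtain ⟨i, hi⟩ := mem_iUnion.1 h
  exact hOK z hz i hi

/-- A set containing a `k`-simplex contains a nonempty relatively open part of a `k`-flat. -/
lemma HasSimplex.exists_flat {d k : ℕ} {S : Set (EuclideanSpace ℝ (Fin d))}
    (h : HasSimplex S k) :
    ∃ H : AffineSubspace ℝ (EuclideanSpace ℝ (Fin d)), finrank ℝ H.direction = k ∧
      ∃ W, IsOpen W ∧ ((H : Set (EuclideanSpace ℝ (Fin d))) ∩ W).Nonempty ∧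
        (H : Set (EuclideanSpace ℝ (Fin d))) ∩ W ⊆ S := by
  obtain ⟨f, hf, hfS⟩ := h
  have hne : (convexHull ℝ (Set.range f)).Nonempty := (range_nonempty f).convexHull
  obtain ⟨x, y, hy, -⟩ := hne.intrinsicInterior (convex_convexHull ℝ _)
  obtain ⟨V, hVsub, hV, hyV⟩ := mem_interior.1 hy
  obtain ⟨W, hW, rfl⟩ := isOpen_induced_iff.1 hV
  refine ⟨affineSpan ℝ (convexHull ℝ (Set.range f)), ?_, W, hW, ⟨y, y.2, hyV⟩, ?_⟩
  · rw [affineSpan_convexHull, direction_affineSpan]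
    exact hf.finrank_vectorSpan (by simp)
  · rintro z ⟨hzH, hzW⟩
    exact hfS (hVsub (show (⟨z, hzH⟩ : affineSpan ℝ _) ∈ _ from hzW))

/-- A `k`-flat meeting an open set `U` contains a `k`-simplex inside `U`. -/
lemma hasSimplex_flat_inter {d k : ℕ} {H : AffineSubspace ℝ (EuclideanSpace ℝ (Fin d))}
    (hH : finrank ℝ H.direction = k) {U : Set (EuclideanSpace ℝ (Fin d))} (hU : IsOpen U)
    (hne : ((H : Set (EuclideanSpace ℝ (Fin d))) ∩ U).Nonempty) :
    HasSimplex ((H : Set (EuclideanSpace ℝ (Fin d))) ∩ U) k := by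
  obtain ⟨ψ, hψ, hrange⟩ := exists_affineMap_range_eq H (hne.mono inter_subset_left) hH
  have h := hasSimplex_image hψ (hU.preimage ψ.continuous_of_finiteDimensional) (by
    obtain ⟨x, hxH, hxU⟩ := hne
    obtain ⟨u, rfl⟩ := hrange.symm ▸ hxH
    exact ⟨u, hxU⟩)
  refine h.mono ?_
  rintro _ ⟨u, hu, rfl⟩
  exact ⟨hrange ▸ mem_range_self u, hu⟩

/-- If an open set `B` contains no simplex of the complement of dimension above `k`, but contains
a `k`-simplex of it, then locally in `B` the complement agrees somewhere with a `k`-flat. -/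
lemma exists_locally_flat {d k : ℕ} {ι : Type*} [Finite ι]
    {K : ι → Set (EuclideanSpace ℝ (Fin d))} (hK : ∀ i, Convex ℝ (K i))
    {B : Set (EuclideanSpace ℝ (Fin d))} (hB : IsOpen B)
    (hsimp : HasSimplex ((⋃ i, K i)ᶜ ∩ B) k)
    (hmax : ∀ m, HasSimplex ((⋃ i, K i)ᶜ ∩ B) m → m ≤ k) :
    ∃ H : AffineSubspace ℝ (EuclideanSpace ℝ (Fin d)), finrank ℝ H.direction = k ∧
      ∃ q ∈ H, ∃ U, IsOpen U ∧ q ∈ U ∧ U ⊆ B ∧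
        (⋃ i, K i)ᶜ ∩ U = (H : Set (EuclideanSpace ℝ (Fin d))) ∩ U := by
  obtain ⟨H, hH, W, hW, hne, hsub⟩ := hsimp.exists_flat
  refine ⟨H, hH, ?_⟩
  by_contra! hcon
  have hPQ : (H : Set (EuclideanSpace ℝ (Fin d))) ∩ W ⊆ closure (((⋃ i, K i)ᶜ ∩ B) \ H) := by
    rintro q ⟨hqH, hqW⟩
    refine mem_closure_iff.2 fun V hV hqV => ?_
    by_contra hempty
    refine hcon q hqH (V ∩ W ∩ B) ((hV.inter hW).inter hB) ⟨⟨hqV, hqW⟩, (hsub ⟨hqH, hqW⟩).2⟩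
      inter_subset_right ?_
    ext x
    constructor
    · rintro ⟨hxS, hx⟩
      refine ⟨?_, hx⟩
      by_contra hxH
      exact hempty ⟨x, hx.1.1, ⟨hxS, hx.2⟩, hxH⟩
    · rintro ⟨hxH, hx⟩
      exact ⟨(hsub ⟨hxH, hx.1.2⟩).1, hx⟩
  obtain ⟨m, φ, hφ, ⟨U, hU, ⟨q, hqP, hqU⟩, hPU⟩, x, ⟨hxQ, u, hu⟩, hx⟩ :=
    exists_flat_accumulating hK (sdiff_subset.trans inter_subset_left) hne hPQ
  obtain ⟨O, hO, hOne, hOS⟩ := hx B hB hxQ.1.2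
  have hmk : m ≤ k := hmax m ((hasSimplex_image hφ hO hOne).mono hOS)
  obtain ⟨ψ, -, hrange⟩ := exists_affineMap_range_eq H ⟨q, hqP.1⟩ hH
  have hle : H ≤ (⊤ : AffineSubspace ℝ _).map φ := by
    intro y hy
    obtain ⟨v, rfl⟩ : y ∈ Set.range ψ := hrange ▸ hy
    obtain ⟨w, hw⟩ : q ∈ Set.range ψ := hrange ▸ hqP.1
    refine mem_of_image_open_subset ψ
      ((hW.inter hU).preimage ψ.continuous_of_finiteDimensional)
      ⟨w, by simpa [hw] using ⟨hqP.2, hqU⟩⟩ ?_ v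
    rintro _ ⟨z, hz, rfl⟩
    have hzH : ψ z ∈ (H : Set (EuclideanSpace ℝ (Fin d))) := hrange ▸ mem_range_self z
    simpa using hPU ⟨⟨hzH, hz.1⟩, hz.2⟩
  have hlt : H < (⊤ : AffineSubspace ℝ _).map φ := by
    refine lt_of_le_of_ne hle fun h => hxQ.2 ?_
    rw [h, ← hu]
    simp
  have hfin := Submodule.finrank_lt_finrank_of_lt
    (AffineSubspace.direction_lt_of_nonempty hlt ⟨q, hqP.1⟩)
  rw [AffineSubspace.map_direction, hH] at hfin
  have hle' := Submodule.finrank_map_le φ.linear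
    ((⊤ : AffineSubspace ℝ (EuclideanSpace ℝ (Fin m))).direction)
  rw [AffineSubspace.direction_top] at hle' hfin
  simp only [finrank_top, finrank_euclideanSpace_fin] at hle'
  omega

/-- Every point `p` of `S = ℝ^d \ (K₁ ∪ … ∪ Kₙ)` with local dimension `k` is a limit
of `k`-ordinary points of `S`, and consequently lies on some `k`-ordinary flat of `S`. -/
theorem ordinary_points_dense_and_flat_through (d n k : ℕ)
    (K : Fin n → Set (EuclideanSpace ℝ (Fin d))) (hK : ∀ i, Convex ℝ (K i))
    (p : EuclideanSpace ℝ (Fin d)) (hp : p ∈ (⋃ i, K i)ᶜ)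
    (hk : dmLoc (⋃ i, K i)ᶜ p = k) :
    (∀ ε > 0, ∃ q, IsOrdinaryPoint (⋃ i, K i)ᶜ k q ∧ dist p q < ε) ∧
    ∃ H : AffineSubspace ℝ (EuclideanSpace ℝ (Fin d)),
      IsOrdinaryFlat (⋃ i, K i)ᶜ k H ∧ p ∈ H := by
  have hdense : ∀ ε > 0, ∃ q, IsOrdinaryPoint (⋃ i, K i)ᶜ k q ∧ dist p q < ε := by
    intro ε hε
    obtain ⟨ε₀, hε₀, h₀⟩ := exists_dmLoc_eq (⋃ i, K i)ᶜ p
    have hδ : 0 < min ε ε₀ := lt_min hε hε₀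
    have hdm := dm_inter_ball_eq hp hδ (min_le_right _ _) h₀
    rw [hk] at hdm
    obtain ⟨H, hH, q, hqH, U, hU, hqU, hUB, heq⟩ :=
      exists_locally_flat hK (isOpen_ball (x := p) (ε := min ε ε₀))
        (hdm ▸ hasSimplex_dm ⟨p, hp, mem_ball_self hδ⟩) fun m hm => hdm ▸ hm.le_dm
    have hqS : q ∈ (⋃ i, K i)ᶜ := (heq.symm.subset ⟨hqH, hqU⟩).1
    refine ⟨q, ⟨hqS, le_antisymm ?_ ?_, H, hH, U, hU, hqU, heq⟩, ?_⟩
    · obtain ⟨r, hr, hrU⟩ := Metric.isOpen_iff.1 hU q hqU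
      refine (dmLoc_le _ q hr).trans (hdm ▸ ?_)
      exact ((hasSimplex_dm (S := (⋃ i, K i)ᶜ ∩ ball q r) ⟨q, hqS, mem_ball_self hr⟩).mono
        (inter_subset_inter_right _ (hrU.trans hUB))).le_dm
    · obtain ⟨r, hr, hdr⟩ := exists_dmLoc_eq (⋃ i, K i)ᶜ q
      rw [hdr]
      refine ((hasSimplex_flat_inter hH (hU.inter isOpen_ball)
        ⟨q, hqH, hqU, mem_ball_self hr⟩).mono ?_).le_dm
      rintro x ⟨hxH, hxU, hxr⟩
      exact ⟨(heq.symm.subset ⟨hxH, hxU⟩).1, hxr⟩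
    · have := hUB hqU
      rw [mem_ball, dist_comm] at this
      exact this.trans_le (min_le_left _ _)
  refine ⟨hdense, ?_⟩
  obtain ⟨m, φ, -, ⟨U, -, ⟨_, rfl, hpU⟩, hrange⟩, x, ⟨hx, -⟩, hopen⟩ :=
    exists_flat_accumulating hK (P := {p}) (Q := {q | IsOrdinaryPoint (⋃ i, K i)ᶜ k q})
      (fun q hq => hq.1) (singleton_nonempty p) (by
        rintro _ rfl
        exact Metric.mem_closure_iff.2 hdense)
  obtain ⟨hxS, hxk, H, hH, V, hV, hxV, heq⟩ := hx
  obtain ⟨O, hO, hOne, hOS⟩ := hopen V hV hxV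
  refine ⟨H, ⟨hH, x, hxS, hxk, V, hV, hxV, heq⟩, ?_⟩
  obtain ⟨u, rfl⟩ := hrange ⟨rfl, hpU⟩
  exact mem_of_image_open_subset φ hO hOne ((hOS.trans heq.subset).trans inter_subset_left) u
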